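/- arXiv:math/0009133 — 6 statements merged into one kernel-verified Lean document; each statement's English description precedes it below -/
import Mathlib

section
/- Let b, k, m be integers with b > k ≥ 1 and m ≥ 1, and set a = mb + k. Then (k−1)(b+k−1)/a + m(b−1)(a+b+k)/a ≥ (b−1)(a+b−1)/b. -/
/-- **(5.3.5).** Let `b, k, m` be integers with `b > k ≥ 1` and `m ≥ 1`, and set
`a = mb + k`. Then `(k−1)(b+k−1)/a + m(b−1)(a+b+k)/a ≥ (b−1)(a+b−1)/b`. -/
theorem ineq_5_3_5 (b k m a : ℤ) (hk : 1 ≤ k) (hkb : k < b) (hm : 1 ≤ m)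
    (ha : a = m * b + k) :
    ((k : ℚ) - 1) * ((b : ℚ) + (k : ℚ) - 1) / (a : ℚ)
      + (m : ℚ) * ((b : ℚ) - 1) * ((a : ℚ) + (b : ℚ) + (k : ℚ)) / (a : ℚ)
      ≥ ((b : ℚ) - 1) * ((a : ℚ) + (b : ℚ) - 1) / (b : ℚ) := by
  have hk' : (1 : ℚ) ≤ k := by exact_mod_cast hk
  have hkb' : (k : ℚ) < b := by exact_mod_cast hkb
  have hm' : (1 : ℚ) ≤ m := by exact_mod_cast hm
  have ha' : (a : ℚ) = m * b + k := by exact_mod_cast ha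
  have hb : (0 : ℚ) < b := by linarith
  have hapos : (0 : ℚ) < a := by rw [ha']; positivity
  have hnum : 0 ≤ (k : ℚ) * (k - 1) + (b - 1) * (m - 1) * b := by
    have h₁ : (0 : ℚ) ≤ k - 1 := by linarith
    have h₂ : (0 : ℚ) ≤ b - 1 := by linarith
    have h₃ : (0 : ℚ) ≤ m - 1 := by linarith
    positivity
  rw [ge_iff_le, ← add_div, div_le_div_iff₀ hb hapos, ← sub_nonneg]
  refine hnum.trans_eq ?_
  rw [ha']
  ring
end

section
/- Let a, b be relatively prime positive integers. Then 12 · ∑_{(i,j)∈ℤ², i>0, j>0, i/a + j/b < 1} (1 − i/a − j/b)² = (a−1)(b−1)(1 − 1/a − 1/b). (This is the identity 6S^{(g)} = μ^{(g)}(1 − 1/w_g − 1/n_g) expressing that Hertling's variance inequality is an equality in the quasihomogeneous, i.e., one-Puiseux-pair, case.) -/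
open Finset

lemma sum_Icc_one_int_succ (f : ℤ → ℚ) (n : ℕ) :
    ∑ i ∈ Icc (1 : ℤ) ((n + 1 : ℕ) : ℤ), f i = ∑ i ∈ Icc (1 : ℤ) n, f i + f (n + 1) := by
  have h : Icc (1 : ℤ) ((n + 1 : ℕ) : ℤ) = insert ((n : ℤ) + 1) (Icc (1 : ℤ) n) := by
    ext i
    simp only [mem_Icc, mem_insert]
    omega
  rw [h, sum_insert (by simp), add_comm]

lemma sum_Icc_sub_mul_sq (c y : ℚ) (n : ℕ) :
    ∑ j ∈ Icc (1 : ℤ) n, (c - j * y) ^ 2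
      = n * c ^ 2 - n * (n + 1) * y * c + n * (n + 1) * (2 * n + 1) / 6 * y ^ 2 := by
  induction n with
  | zero => simp
  | succ n ih =>
    rw [sum_Icc_one_int_succ, ih]
    push_cast
    ring

lemma sum_Icc_sum_Icc_sq (x y : ℚ) (m n : ℕ) :
    ∑ i ∈ Icc (1 : ℤ) m, ∑ j ∈ Icc (1 : ℤ) n, (1 - i * x - j * y) ^ 2
      = n * (m - m * (m + 1) * x + m * (m + 1) * (2 * m + 1) / 6 * x ^ 2)
        - n * (n + 1) * y * (m - m * (m + 1) / 2 * x)
        + m * (n * (n + 1) * (2 * n + 1) / 6 * y ^ 2) := by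
  simp only [sum_Icc_sub_mul_sq]
  induction m with
  | zero => simp
  | succ m ih =>
    rw [sum_Icc_one_int_succ, ih]
    push_cast
    ring

/-- The reflection `(i, j) ↦ (m + 1 - i, n + 1 - j)` changes the sign of
`1 - i / (m + 1) - j / (n + 1)`, so the positive part of the grid carries half of the sum of
squares. -/
lemma two_mul_sum_pos_part_sq (m n : ℕ) :
    2 * ∑ p ∈ Icc (1 : ℤ) m ×ˢ Icc (1 : ℤ) n,
        (if (p.1 : ℚ) / (m + 1) + (p.2 : ℚ) / (n + 1) < 1 then
          (1 - (p.1 : ℚ) / (m + 1) - (p.2 : ℚ) / (n + 1)) ^ 2 else 0)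
      = ∑ p ∈ Icc (1 : ℤ) m ×ˢ Icc (1 : ℤ) n,
        (1 - (p.1 : ℚ) / (m + 1) - (p.2 : ℚ) / (n + 1)) ^ 2 := by
  have hm : (m : ℚ) + 1 ≠ 0 := by positivity
  have hn : (n : ℚ) + 1 ≠ 0 := by positivity
  have reflect : ∑ p ∈ Icc (1 : ℤ) m ×ˢ Icc (1 : ℤ) n,
        (if (p.1 : ℚ) / (m + 1) + (p.2 : ℚ) / (n + 1) < 1 then
          (1 - (p.1 : ℚ) / (m + 1) - (p.2 : ℚ) / (n + 1)) ^ 2 else 0)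
      = ∑ p ∈ Icc (1 : ℤ) m ×ˢ Icc (1 : ℤ) n,
        (if 1 < (p.1 : ℚ) / (m + 1) + (p.2 : ℚ) / (n + 1) then
          (1 - (p.1 : ℚ) / (m + 1) - (p.2 : ℚ) / (n + 1)) ^ 2 else 0) := by
    refine sum_nbij' (fun p => (m + 1 - p.1, n + 1 - p.2)) (fun p => (m + 1 - p.1, n + 1 - p.2))
      ?_ ?_ ?_ ?_ ?_
    · intro p hp
      simp only [mem_product, mem_Icc] at hp ⊢
      omega
    · intro p hp
      simp only [mem_product, mem_Icc] at hp ⊢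
      omega
    · intro p _
      simp
    · intro p _
      simp
    · intro p _
      push_cast
      simp only [sub_div, div_self hm, div_self hn]
      refine if_congr ?_ ?_ rfl
      · constructor <;> intro h <;> linarith
      · ring
  rw [two_mul]
  nth_rewrite 2 [reflect]
  rw [← sum_add_distrib]
  refine sum_congr rfl fun p _ => ?_
  rcases lt_trichotomy ((p.1 : ℚ) / (m + 1) + (p.2 : ℚ) / (n + 1)) 1 with h | h | h
  · simp [h, h.le]
  · simp [sub_sub, h]
  · simp [h, h.le]

/-- **(5.2.2), quasihomogeneous case.** For relatively prime positive integers `a, b`,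
`12 · ∑_{i>0, j>0, i/a + j/b < 1} (1 − i/a − j/b)² = (a−1)(b−1)(1 − 1/a − 1/b)`.
(The conditions `i, j > 0`, `i/a + j/b < 1` force `1 ≤ i ≤ a` and `1 ≤ j ≤ b`.) -/
theorem twelve_mul_sum_sq (a b : ℕ) (ha : 0 < a) (hb : 0 < b) (hcop : Nat.Coprime a b) :
    12 * ∑ p ∈ (Finset.Icc 1 (a : ℤ) ×ˢ Finset.Icc 1 (b : ℤ)).filter
        (fun p => (p.1 : ℚ) / a + (p.2 : ℚ) / b < 1),
        (1 - (p.1 : ℚ) / a - (p.2 : ℚ) / b) ^ 2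
      = ((a : ℚ) - 1) * ((b : ℚ) - 1) * (1 - 1 / (a : ℚ) - 1 / (b : ℚ)) := by
  obtain ⟨m, rfl⟩ := Nat.exists_eq_add_one.mpr ha
  obtain ⟨n, rfl⟩ := Nat.exists_eq_add_one.mpr hb
  have hm : (0 : ℚ) < (m : ℚ) + 1 := by positivity
  have hn : (0 : ℚ) < (n : ℚ) + 1 := by positivity
  push_cast
  have restrict : (Icc 1 ((m : ℤ) + 1) ×ˢ Icc 1 ((n : ℤ) + 1)).filter
        (fun p => (p.1 : ℚ) / (m + 1) + (p.2 : ℚ) / (n + 1) < 1)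
      = (Icc 1 (m : ℤ) ×ˢ Icc 1 (n : ℤ)).filter
        (fun p => (p.1 : ℚ) / (m + 1) + (p.2 : ℚ) / (n + 1) < 1) := by
    ext ⟨i, j⟩
    simp only [mem_filter, mem_product, mem_Icc]
    refine ⟨fun ⟨⟨⟨hi, _⟩, hj, _⟩, h⟩ => ?_, fun ⟨_, h⟩ => ⟨by omega, h⟩⟩
    have hi' : (0 : ℚ) < i := by exact_mod_cast hi
    have hj' : (0 : ℚ) < j := by exact_mod_cast hj
    have hx : (i : ℚ) / (m + 1) < 1 := by linarith [div_pos hj' hn]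
    have hy : (j : ℚ) / (n + 1) < 1 := by linarith [div_pos hi' hm]
    rw [div_lt_one hm] at hx
    rw [div_lt_one hn] at hy
    have hx' : i < m + 1 := by exact_mod_cast hx
    have hy' : j < n + 1 := by exact_mod_cast hy
    exact ⟨by omega, h⟩
  rw [restrict, sum_filter, show (12 : ℚ) = 6 * 2 by norm_num, mul_assoc,
    two_mul_sum_pos_part_sq, sum_product]
  simp only [div_eq_mul_inv _ ((m : ℚ) + 1), div_eq_mul_inv _ ((n : ℚ) + 1), sum_Icc_sum_Icc_sq]
  field_simp
  ring
end

section
/- Let g ≥ 2 and let (k₁,n₁),…,(k_g,n_g) be pairs of coprime positive integers with n_ν > 1 for all ν and k₁ > n₁. Then 12 · ∑_{ν=1}^{g} ∑_{(i,j,r)} (1 − (i/n_ν + j/w_ν)/n'_ν − r/n'_ν)² < (∑_{ν=1}^{g} (w_ν−1)(n_ν−1)n'_ν) · (1 − (k₁+n₁)/(k₁·n'₀)), where the inner sum runs over all integer triples (i,j,r) with 0 < i < n_ν, 0 < j < w_ν, 0 ≤ r < n'_ν and i/n_ν + j/w_ν < 1. (This is the combinatorial form of Theorem 5.2: for an irreducible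 plane curve singularity with g ≥ 2 Puiseux pairs, whose exponents less than 1 are the numbers (i/n_ν + j/w_ν + r)/n'_ν above and whose remaining exponents are obtained by the symmetry α ↦ 2−α, the variance of the exponents is strictly less than (α_μ − α₁)/12, proving Hertling's conjecture in this case.) -/
open Finset

/-- `n'_ν = n_{ν+1} ⋯ n_g`. -/
def nprod (g : ℕ) (n : ℕ → ℕ) (ν : ℕ) : ℕ :=
  ∏ μ ∈ Finset.Icc (ν + 1) g, n μ

lemma sum_Ioo_zero_eq_sum_range_sub (a : ℕ) (ha : 0 < a) (f : ℕ → ℚ) :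
    ∑ i ∈ Ioo 0 a, f i = ∑ i ∈ range a, f i - f 0 := by
  have h : range a = insert 0 (Ioo 0 a) := by
    ext i; simp only [mem_range, mem_insert, mem_Ioo]; omega
  rw [h, sum_insert (by simp)]
  ring

lemma sum_range_quadratic (n : ℕ) (A B C : ℚ) :
    ∑ r ∈ range n, (A + B * r + C * (r : ℚ) ^ 2)
      = A * n + B * (n * (n - 1) / 2) + C * (n * (n - 1) * (2 * n - 1) / 6) := by
  induction n with
  | zero => simp
  | succ n ih => rw [sum_range_succ, ih]; push_cast; ring

lemma sum_range_sq_shift (N : ℕ) (hN : 0 < N) (v : ℚ) :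
    ∑ r ∈ range N, (1 - v / N - (r : ℚ) / N) ^ 2
      = ((1 - v) ^ 2 + (1 - v) * (N - 1) + (N - 1) * (2 * N - 1) / 6) / N := by
  have hN' : (N : ℚ) ≠ 0 := by positivity
  have h : ∀ r ∈ range N, (1 - v / N - (r : ℚ) / N) ^ 2
      = (1 - v / N) ^ 2 + (-2 * (1 - v / N) / N) * r + (1 / (N : ℚ) ^ 2) * (r : ℚ) ^ 2 := by
    intro r _; field_simp; ring
  rw [sum_congr rfl h, sum_range_quadratic]
  field_simp
  ring

lemma sum_Ioo_sum_Ioo_sq (a b : ℕ) (ha : 0 < a) (hb : 0 < b) :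
    ∑ i ∈ Ioo 0 a, ∑ j ∈ Ioo 0 b, (1 - ((i : ℚ) / a + (j : ℚ) / b)) ^ 2
      = ((a : ℚ) - 1) * (b - 1) * (1 - 1 / a - 1 / b) / 6 := by
  have ha' : (a : ℚ) ≠ 0 := by positivity
  have hb' : (b : ℚ) ≠ 0 := by positivity
  have h1 : ∀ i ∈ Ioo 0 a, ∑ j ∈ Ioo 0 b, (1 - ((i : ℚ) / a + (j : ℚ) / b)) ^ 2
      = (b - 1) * (1 - (i : ℚ) / a) ^ 2 - (1 - (i : ℚ) / a) * (b - 1)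
        + (b - 1) * (2 * b - 1) / (6 * b) := by
    intro i _
    have h : ∀ j ∈ range b, (1 - ((i : ℚ) / a + (j : ℚ) / b)) ^ 2
      = (1 - (i : ℚ) / a) ^ 2 + (-2 * (1 - (i : ℚ) / a) / b) * j
        + (1 / (b : ℚ) ^ 2) * (j : ℚ) ^ 2 := by
      intro j _; field_simp; ring
    rw [sum_Ioo_zero_eq_sum_range_sub b hb, sum_congr rfl h, sum_range_quadratic]
    field_simp
    push_cast
    ring
  rw [sum_congr rfl h1, sum_Ioo_zero_eq_sum_range_sub a ha]
  have h2 : ∀ i ∈ range a, (b - 1) * (1 - (i : ℚ) / a) ^ 2 - (1 - (i : ℚ) / a) * (b - 1)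
        + (b - 1) * (2 * b - 1) / (6 * b)
      = (b - 1) * (2 * b - 1) / (6 * b) + (-((b : ℚ) - 1) / a) * i
        + (((b : ℚ) - 1) / (a : ℚ) ^ 2) * (i : ℚ) ^ 2 := by
    intro i _; field_simp; ring
  rw [sum_congr rfl h2, sum_range_quadratic]
  field_simp
  push_cast
  ring

lemma sum_range_fract_sq (n : ℕ) (hn : 0 < n) :
    ∑ t ∈ range n, ((t : ℚ) / n - 1 / 2) ^ 2 = ((n : ℚ) + 2 / n) / 12 := by
  have hn' : (n : ℚ) ≠ 0 := by positivity
  have h : ∀ t ∈ range n, ((t : ℚ) / n - 1 / 2) ^ 2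
      = 1 / 4 + (-1 / n) * t + (1 / (n : ℚ) ^ 2) * (t : ℚ) ^ 2 := by
    intro t _; field_simp; ring
  rw [sum_congr rfl h, sum_range_quadratic]
  field_simp
  ring

lemma fract_div_add_div (a b i j : ℕ) (ha : 0 < a) (hb : 0 < b) :
    Int.fract ((i : ℚ) / a + (j : ℚ) / b)
      = (((i * b + j * a) % (a * b) : ℕ) : ℚ) / ((a * b : ℕ) : ℚ) := by
  have ha' : (a : ℚ) ≠ 0 := by positivity
  have hb' : (b : ℚ) ≠ 0 := by positivity
  rw [← Int.fract_div_natCast_eq_div_natCast_mod]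
  congr 1
  push_cast
  field_simp

lemma sum_range_sum_range_mod (a b : ℕ) (ha : 0 < a) (hb : 0 < b) (hab : Nat.Coprime a b)
    (f : ℕ → ℚ) :
    ∑ i ∈ range a, ∑ j ∈ range b, f ((i * b + j * a) % (a * b)) = ∑ t ∈ range (a * b), f t := by
  rw [← sum_product']
  have hmaps : ∀ p ∈ range a ×ˢ range b, (p.1 * b + p.2 * a) % (a * b) ∈ range (a * b) :=
    fun p _ => mem_range.2 (Nat.mod_lt _ (by positivity))
  have hinj : Set.InjOn (fun p : ℕ × ℕ => (p.1 * b + p.2 * a) % (a * b))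
      ((range a ×ˢ range b : Finset (ℕ × ℕ)) : Set (ℕ × ℕ)) := by
    rintro ⟨i, j⟩ hp ⟨i', j'⟩ hq h
    simp only [coe_product, Set.mem_prod, mem_coe, mem_range] at hp hq
    have h' : i * b + j * a ≡ i' * b + j' * a [MOD a * b] := h
    have e1 : i * b ≡ i' * b [MOD a] := by
      simpa [Nat.ModEq, Nat.add_mul_mod_self_right] using h'.of_mul_right b
    have e2 : j * a ≡ j' * a [MOD b] := by
      simpa [Nat.ModEq, Nat.mul_add_mod_self_right] using h'.of_mul_left a
    have e3 := (Nat.ModEq.cancel_right_of_coprime hab e1).eq_of_lt_of_lt hp.1 hq.1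
    have e4 := (Nat.ModEq.cancel_right_of_coprime hab.symm e2).eq_of_lt_of_lt hp.2 hq.2
    rw [e3, e4]
  refine sum_nbij (fun p => (p.1 * b + p.2 * a) % (a * b)) hmaps hinj ?_ (fun _ _ => rfl)
  exact surjOn_of_injOn_of_card_le _ hmaps hinj (by simp)

lemma sum_Ioo_sum_Ioo_fract_sq (a b : ℕ) (ha : 0 < a) (hb : 0 < b) (hab : Nat.Coprime a b) :
    ∑ i ∈ Ioo 0 a, ∑ j ∈ Ioo 0 b, (Int.fract ((i : ℚ) / a + (j : ℚ) / b) - 1 / 2) ^ 2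
      = ((a : ℚ) - 1) * (b - 1) * (1 + 2 / (a * b)) / 12 := by
  have ha' : (a : ℚ) ≠ 0 := by positivity
  have hb' : (b : ℚ) ≠ 0 := by positivity
  have hfull : ∑ i ∈ range a, ∑ j ∈ range b,
      (Int.fract ((i : ℚ) / a + (j : ℚ) / b) - 1 / 2) ^ 2
        = (((a * b : ℕ) : ℚ) + 2 / ((a * b : ℕ) : ℚ)) / 12 := by
    rw [← sum_range_fract_sq (a * b) (by positivity), ← sum_range_sum_range_mod a b ha hb hab]
    simp only [fract_div_add_div a b _ _ ha hb]
  have hfract : ∀ n t : ℕ, t ∈ range n → Int.fract ((t : ℚ) / n) = (t : ℚ) / n := by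
    intro n t ht
    have ht' := mem_range.1 ht
    rw [Int.fract_div_natCast_eq_div_natCast_mod, Nat.mod_eq_of_lt ht']
  have hrow : ∑ j ∈ range b, (Int.fract (((0 : ℕ) : ℚ) / a + (j : ℚ) / b) - 1 / 2) ^ 2
      = ((b : ℚ) + 2 / b) / 12 := by
    rw [← sum_range_fract_sq b hb]
    refine sum_congr rfl fun j hj => ?_
    rw [Nat.cast_zero, zero_div, zero_add, hfract b j hj]
  have hcol : ∑ i ∈ range a, (Int.fract ((i : ℚ) / a + ((0 : ℕ) : ℚ) / b) - 1 / 2) ^ 2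
      = ((a : ℚ) + 2 / a) / 12 := by
    rw [← sum_range_fract_sq a ha]
    refine sum_congr rfl fun i hi => ?_
    rw [Nat.cast_zero, zero_div, add_zero, hfract a i hi]
  simp only [sum_Ioo_zero_eq_sum_range_sub b hb]
  rw [sum_Ioo_zero_eq_sum_range_sub a ha, sum_sub_distrib, hfull, hrow, hcol]
  simp only [Nat.cast_zero, zero_div, add_zero, Int.fract_zero]
  push_cast
  field_simp
  ring

lemma abs_one_sub_eq_fract (v : ℚ) (h0 : 0 ≤ v) (h2 : v < 2) :
    |1 - v| = (1 - v) ^ 2 + 1 / 4 - (Int.fract v - 1 / 2) ^ 2 := by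
  rcases lt_or_ge v 1 with h | h
  · rw [abs_of_pos (by linarith), Int.fract_eq_self.2 ⟨h0, h⟩]
    ring
  · have hf : Int.fract v = v - 1 := by
      rw [← Int.fract_sub_one]
      exact Int.fract_eq_self.2 ⟨by linarith, by linarith⟩
    rw [abs_of_nonpos (by linarith), hf]
    ring

lemma sum_Ioo_sum_Ioo_abs (a b : ℕ) (ha : 0 < a) (hb : 0 < b) (hab : Nat.Coprime a b) :
    ∑ i ∈ Ioo 0 a, ∑ j ∈ Ioo 0 b, |1 - ((i : ℚ) / a + (j : ℚ) / b)|
      = ((a : ℚ) - 1) * (b - 1) * (2 - 1 / a - 1 / b - 1 / (a * b)) / 6 := by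
  have ha' : (0 : ℚ) < a := by positivity
  have hb' : (0 : ℚ) < b := by positivity
  have h : ∀ i ∈ Ioo 0 a, ∀ j ∈ Ioo 0 b, |1 - ((i : ℚ) / a + (j : ℚ) / b)|
      = (1 - ((i : ℚ) / a + (j : ℚ) / b)) ^ 2 + 1 / 4
        - (Int.fract ((i : ℚ) / a + (j : ℚ) / b) - 1 / 2) ^ 2 := by
    intro i hi j hj
    have h1 : (i : ℚ) / a < 1 := (div_lt_one ha').2 (by exact_mod_cast (mem_Ioo.1 hi).2)
    have h2 : (j : ℚ) / b < 1 := (div_lt_one hb').2 (by exact_mod_cast (mem_Ioo.1 hj).2)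
    exact abs_one_sub_eq_fract _ (by positivity) (by linarith)
  rw [sum_congr rfl fun i hi => sum_congr rfl (h i hi)]
  simp only [sum_sub_distrib, sum_add_distrib]
  rw [sum_Ioo_sum_Ioo_sq a b ha hb, sum_Ioo_sum_Ioo_fract_sq a b ha hb hab]
  simp only [sum_const, Nat.card_Ioo, nsmul_eq_mul, Nat.sub_zero]
  rw [Nat.cast_sub (by omega), Nat.cast_sub (by omega)]
  push_cast
  field_simp
  ring

lemma sum_Ioo_reflect (a : ℕ) (f : ℕ → ℚ) :
    ∑ i ∈ Ioo 0 a, f (a - i) = ∑ i ∈ Ioo 0 a, f i := by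
  refine sum_nbij' (fun i => a - i) (fun i => a - i) ?_ ?_ ?_ ?_ (fun _ _ => rfl) <;>
  · intro i hi
    simp only [mem_Ioo] at hi ⊢
    omega

lemma div_add_div_ne_one (a b i j : ℕ) (hab : Nat.Coprime a b) (hi : i ∈ Ioo 0 a)
    (hb : 0 < b) : (i : ℚ) / a + (j : ℚ) / b ≠ 1 := by
  intro h
  rw [mem_Ioo] at hi
  have ha : 0 < a := by omega
  have ha' : (a : ℚ) ≠ 0 := by positivity
  have hb' : (b : ℚ) ≠ 0 := by positivity
  field_simp at h
  have h' : i * b + a * j = a * b := by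
    have : (i : ℚ) * b + a * j = a * b := by linarith
    exact_mod_cast this
  have hd : a ∣ i * b := (Nat.dvd_add_left (dvd_mul_right a j)).1 (h' ▸ dvd_mul_right a b)
  exact absurd (Nat.le_of_dvd hi.1 (hab.dvd_of_dvd_mul_right hd)) (by omega)

lemma two_mul_sum_Ioo_sum_Ioo_ite (a b : ℕ) (hb : 0 < b) (hab : Nat.Coprime a b)
    (q : ℚ → ℚ) :
    2 * ∑ i ∈ Ioo 0 a, ∑ j ∈ Ioo 0 b,
        (if (i : ℚ) / a + (j : ℚ) / b < 1 then q (1 - ((i : ℚ) / a + (j : ℚ) / b)) else 0)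
      = ∑ i ∈ Ioo 0 a, ∑ j ∈ Ioo 0 b, q |1 - ((i : ℚ) / a + (j : ℚ) / b)| := by
  have hrefl : ∑ i ∈ Ioo 0 a, ∑ j ∈ Ioo 0 b,
      (if (i : ℚ) / a + (j : ℚ) / b < 1 then q (1 - ((i : ℚ) / a + (j : ℚ) / b)) else 0)
      = ∑ i ∈ Ioo 0 a, ∑ j ∈ Ioo 0 b,
        (if 1 < (i : ℚ) / a + (j : ℚ) / b then q ((i : ℚ) / a + (j : ℚ) / b - 1) else 0) := by
    rw [← sum_Ioo_reflect a]
    refine sum_congr rfl fun i hi => ?_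
    rw [← sum_Ioo_reflect b]
    refine sum_congr rfl fun j hj => ?_
    rw [mem_Ioo] at hi hj
    have ha' : (a : ℚ) ≠ 0 := by
      have : 0 < a := by omega
      positivity
    have hb' : (b : ℚ) ≠ 0 := by positivity
    have e : ((a - i : ℕ) : ℚ) / a + ((b - j : ℕ) : ℚ) / b
        = 2 - ((i : ℚ) / a + (j : ℚ) / b) := by
      rw [Nat.cast_sub hi.2.le, Nat.cast_sub hj.2.le]
      field_simp
      ring
    rw [e]
    refine if_congr ⟨fun h => by linarith, fun h => by linarith⟩ ?_ rfl
    congr 1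
    ring
  rw [two_mul]
  nth_rewrite 2 [hrefl]
  rw [← sum_add_distrib]
  refine sum_congr rfl fun i hi => ?_
  rw [← sum_add_distrib]
  refine sum_congr rfl fun j _ => ?_
  rcases lt_or_gt_of_ne (div_add_div_ne_one a b i j hab hi hb) with h | h
  · rw [if_pos h, if_neg (by linarith), abs_of_pos (by linarith), add_zero]
  · rw [if_neg (by linarith), if_pos h, abs_of_neg (by linarith), zero_add, neg_sub]

/-- The contribution of one Puiseux pair, in closed form. -/
lemma twelve_mul_sum_sq_s7 (a b N : ℕ) (ha : 0 < a) (hb : 0 < b) (hN : 0 < N)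
    (hab : Nat.Coprime a b) :
    12 * ∑ i ∈ Ioo 0 a, ∑ j ∈ Ioo 0 b, ∑ r ∈ range N,
        (if (i : ℚ) / a + (j : ℚ) / b < 1 then
          (1 - ((i : ℚ) / a + (j : ℚ) / b) / N - (r : ℚ) / N) ^ 2 else 0)
      = ((b : ℚ) - 1) * (a - 1) * (2 * N - 1 - 1 / a - 1 / b - (1 - 1 / N) / (a * b)) := by
  have ha' : (a : ℚ) ≠ 0 := by positivity
  have hb' : (b : ℚ) ≠ 0 := by positivity
  have hN' : (N : ℚ) ≠ 0 := by positivity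
  set q : ℚ → ℚ := fun s => (s ^ 2 + s * (N - 1) + (N - 1) * (2 * N - 1) / 6) / N with hq
  have h1 : ∀ i j : ℕ, ∑ r ∈ range N,
        (if (i : ℚ) / a + (j : ℚ) / b < 1 then
          (1 - ((i : ℚ) / a + (j : ℚ) / b) / N - (r : ℚ) / N) ^ 2 else 0)
      = if (i : ℚ) / a + (j : ℚ) / b < 1 then q (1 - ((i : ℚ) / a + (j : ℚ) / b)) else 0 := by
    intro i j
    split_ifs
    · exact sum_range_sq_shift N hN _
    · exact sum_const_zero
  simp only [h1]
  have h2 := two_mul_sum_Ioo_sum_Ioo_ite a b hb hab q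
  have h3 : ∑ i ∈ Ioo 0 a, ∑ j ∈ Ioo 0 b, q |1 - ((i : ℚ) / a + (j : ℚ) / b)|
      = (((a : ℚ) - 1) * (b - 1) * (1 - 1 / a - 1 / b) / 6
        + ((a : ℚ) - 1) * (b - 1) * (2 - 1 / a - 1 / b - 1 / (a * b)) / 6 * (N - 1)
        + ((a : ℚ) - 1) * (b - 1) * ((N - 1) * (2 * N - 1) / 6)) / N := by
    rw [← sum_Ioo_sum_Ioo_sq a b ha hb, ← sum_Ioo_sum_Ioo_abs a b ha hb hab]
    simp only [hq, sq_abs, ← sum_div, sum_add_distrib, ← sum_mul]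
    simp only [sum_const, Nat.card_Ioo, nsmul_eq_mul, Nat.sub_zero]
    rw [Nat.cast_sub (by omega), Nat.cast_sub (by omega)]
    push_cast
    ring
  rw [h3] at h2
  rw [show (12 : ℚ) = 6 * 2 by norm_num, mul_assoc, h2]
  field_simp
  ring

lemma nprod_self (g : ℕ) (n : ℕ → ℕ) : nprod g n g = 1 := by
  simp [nprod]

lemma nprod_succ (g : ℕ) (n : ℕ → ℕ) {ν : ℕ} (h : ν ≤ g) :
    nprod (g + 1) n ν = nprod g n ν * n (g + 1) := by
  rw [nprod, nprod, ← prod_Icc_succ_top (by omega)]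

lemma nprod_pos {g : ℕ} {n : ℕ → ℕ} (ν : ℕ) (h : ∀ μ, 1 ≤ μ → μ ≤ g → 1 < n μ) :
    0 < nprod g n ν := by
  refine prod_pos fun μ hμ => ?_
  rw [mem_Icc] at hμ
  have := h μ (by omega) hμ.2
  omega

/-- The sum over all Puiseux pairs of the closed forms in `twelve_mul_sum_sq`. -/
def varSum (g : ℕ) (n w : ℕ → ℕ) : ℚ :=
  ∑ ν ∈ Icc 1 g, ((w ν : ℚ) - 1) * ((n ν : ℚ) - 1) *
    (2 * (nprod g n ν : ℚ) - 1 - 1 / n ν - 1 / w ν - (1 - 1 / (nprod g n ν : ℚ)) / (n ν * w ν))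

/-- The Milnor number. -/
def milnorSum (g : ℕ) (n w : ℕ → ℕ) : ℚ :=
  ∑ ν ∈ Icc 1 g, ((w ν : ℚ) - 1) * ((n ν : ℚ) - 1) * (nprod g n ν : ℚ)

lemma milnorSum_succ (g : ℕ) (n w : ℕ → ℕ) :
    milnorSum (g + 1) n w = n (g + 1) * milnorSum g n w
      + ((w (g + 1) : ℚ) - 1) * ((n (g + 1) : ℚ) - 1) := by
  rw [milnorSum, sum_Icc_succ_top (by omega), nprod_self, milnorSum, mul_sum]
  congr 1
  · refine sum_congr rfl fun ν hν => ?_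
    rw [nprod_succ g n (mem_Icc.1 hν).2]
    push_cast
    ring
  · simp

lemma varSum_succ_le (g : ℕ) (n w : ℕ → ℕ) (hg : 1 ≤ g)
    (hn : ∀ ν, 1 ≤ ν → ν ≤ g + 1 → 1 < n ν) (hw : ∀ ν, 1 ≤ ν → ν ≤ g → 1 < w ν) :
    varSum (g + 1) n w ≤ varSum g n w
      + ((n (g + 1) : ℚ) - 1) * (2 * milnorSum g n w
        - ((w g : ℚ) - 1) * ((n g : ℚ) - 1) / (n (g + 1) * (n g * w g)))
      + ((w (g + 1) : ℚ) - 1) * ((n (g + 1) : ℚ) - 1)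
        * (1 - 1 / n (g + 1) - 1 / w (g + 1)) := by
  have hn' : (1 : ℚ) < n (g + 1) := by exact_mod_cast hn (g + 1) (by omega) le_rfl
  have key : ∑ ν ∈ Icc 1 g, ((w ν : ℚ) - 1) * ((n ν : ℚ) - 1) *
      (2 * (nprod (g + 1) n ν : ℚ) - 1 - 1 / n ν - 1 / w ν
        - (1 - 1 / (nprod (g + 1) n ν : ℚ)) / (n ν * w ν))
      = varSum g n w + ((n (g + 1) : ℚ) - 1) * (2 * milnorSum g n w
        - ∑ ν ∈ Icc 1 g, ((w ν : ℚ) - 1) * ((n ν : ℚ) - 1)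
            / (n (g + 1) * nprod g n ν * (n ν * w ν))) := by
    rw [varSum, milnorSum, mul_sum, ← sum_sub_distrib, mul_sum, ← sum_add_distrib]
    refine sum_congr rfl fun ν hν => ?_
    rw [mem_Icc] at hν
    rw [nprod_succ g n hν.2]
    have h1 : (n ν : ℚ) ≠ 0 := by
      have := hn ν hν.1 (by omega)
      positivity
    have h2 : (w ν : ℚ) ≠ 0 := by
      have := hw ν hν.1 (by omega)
      positivity
    have h3 : (nprod g n ν : ℚ) ≠ 0 := by
      have := nprod_pos (g := g) (n := n) ν fun μ h h' => hn μ h (by omega)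
      positivity
    have h4 : (n (g + 1) : ℚ) ≠ 0 := by positivity
    push_cast
    field_simp
    ring
  have hle : ((w g : ℚ) - 1) * ((n g : ℚ) - 1) / (n (g + 1) * (n g * w g))
      ≤ ∑ ν ∈ Icc 1 g, ((w ν : ℚ) - 1) * ((n ν : ℚ) - 1)
            / (n (g + 1) * nprod g n ν * (n ν * w ν)) := by
    have := single_le_sum (s := Icc 1 g) (f := fun ν => ((w ν : ℚ) - 1) * ((n ν : ℚ) - 1)
            / (n (g + 1) * nprod g n ν * (n ν * w ν))) (fun ν hν => by
      rw [mem_Icc] at hν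
      have h1 : (1 : ℚ) ≤ n ν := by exact_mod_cast (hn ν hν.1 (by omega)).le
      have h2 : (1 : ℚ) ≤ w ν := by exact_mod_cast (hw ν hν.1 hν.2).le
      exact div_nonneg (mul_nonneg (by linarith) (by linarith)) (by positivity))
      (mem_Icc.2 ⟨hg, le_rfl⟩)
    simpa [nprod_self] using this
  rw [varSum, sum_Icc_succ_top (by omega), key, nprod_self]
  have := mul_le_mul_of_nonneg_left hle (sub_nonneg.2 hn'.le)
  push_cast
  simp only [div_one, sub_self, zero_div]
  nlinarith

/-- The inductive step: `f` stands for `(k₁ + n₁) / (k₁ n'₀)`, and `W` for `w_g n_g`. -/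
lemma step_lt (L L' M M' f n W w' k m : ℚ) (hn : 1 < n) (hW : 0 < W)
    (hk : 1 ≤ k) (hw' : w' = W * n + k) (hm : 1 ≤ m) (hf : f < 1)
    (hM : M ≤ W * (1 - f) + 1) (hM' : M' = n * M + (w' - 1) * (n - 1))
    (hL : L ≤ M * (1 - f))
    (hL' : L' ≤ L + (n - 1) * (2 * M - m / (n * W)) + (w' - 1) * (n - 1) * (1 - 1 / n - 1 / w')) :
    L' < M' * (1 - f / n) := by
  have hnW : 0 < n * W := by positivity
  have hw0 : n * W < w' := by linarith
  have hw1 : 0 < w' := by linarith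
  have h1 : 1 / w' < m / (n * W) :=
    (one_div_lt_one_div_of_lt hnW hw0).trans_le (by gcongr)
  have h2 : W * (1 - f) ≤ (w' - 1) / n * (1 - f) := by
    refine mul_le_mul_of_nonneg_right ?_ (by linarith)
    rw [le_div_iff₀ (by linarith)]
    linarith
  have h3 : M - m / (n * W) < (w' - 1) * (1 / n + 1 / w' - f / n) := by
    have e : (w' - 1) * (1 / n + 1 / w' - f / n) = (w' - 1) / n * (1 - f) + 1 - 1 / w' := by
      field_simp
      ring
    rw [e]
    linarith
  have h4 := mul_lt_mul_of_pos_left h3 (sub_pos.2 hn)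
  have e : M' * (1 - f / n) = M * (1 - f) + (n - 1) * M + (w' - 1) * (n - 1) * (1 - f / n) := by
    rw [hM']
    field_simp
    ring
  rw [e]
  linarith

/-- **Theorem 5.2 (combinatorial form).** For an irreducible plane curve singularity
with `g ≥ 2` Puiseux pairs `(k_ν, n_ν)` (coprime, `n_ν > 1`, `k₁ > n₁`), with
`w₁ = k₁`, `w_ν = w_{ν−1} n_{ν−1} n_ν + k_ν`, `n'_ν = n_{ν+1} ⋯ n_g`:
`12 ∑_ν ∑_{(i,j,r)} (1 − (i/n_ν + j/w_ν)/n'_ν − r/n'_ν)²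
  < (∑_ν (w_ν−1)(n_ν−1) n'_ν) · (1 − (k₁+n₁)/(k₁ n'₀))`. -/
theorem variance_lt (g : ℕ) (hg : 2 ≤ g) (k n w : ℕ → ℕ)
    (hpairs : ∀ ν, 1 ≤ ν → ν ≤ g → Nat.Coprime (k ν) (n ν) ∧ 0 < k ν ∧ 1 < n ν)
    (hk1 : n 1 < k 1)
    (hw1 : w 1 = k 1)
    (hw : ∀ ν, 1 < ν → ν ≤ g → w ν = w (ν - 1) * n (ν - 1) * n ν + k ν) :
    12 * ∑ ν ∈ Finset.Icc 1 g, ∑ i ∈ Finset.Ioo 0 (n ν), ∑ j ∈ Finset.Ioo 0 (w ν),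
        ∑ r ∈ Finset.range (nprod g n ν),
          (if (i : ℚ) / (n ν) + (j : ℚ) / (w ν) < 1 then
            (1 - ((i : ℚ) / (n ν) + (j : ℚ) / (w ν)) / (nprod g n ν)
               - (r : ℚ) / (nprod g n ν)) ^ 2
          else 0)
      < (∑ ν ∈ Finset.Icc 1 g, ((w ν : ℚ) - 1) * ((n ν : ℚ) - 1) * (nprod g n ν : ℚ))
          * (1 - ((k 1 : ℚ) + (n 1 : ℚ)) / ((k 1 : ℚ) * (nprod g n 0 : ℚ))) := by
  have hn : ∀ ν, 1 ≤ ν → ν ≤ g → 1 < n ν := fun ν h h' => (hpairs ν h h').2.2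
  have hwgt : ∀ ν, 1 ≤ ν → ν ≤ g → 1 < w ν := by
    intro ν h1
    induction ν, h1 using Nat.le_induction with
    | base =>
      intro h
      have := hn 1 le_rfl h
      omega
    | succ ν h1 ih =>
      intro h
      have hw0 := ih (by omega)
      rw [hw (ν + 1) (by omega) h, Nat.add_sub_cancel]
      have a1 := hn ν h1 (by omega)
      have a2 := hn (ν + 1) (by omega) h
      have := Nat.mul_pos (Nat.mul_pos (by omega : 0 < w ν) (by omega : 0 < n ν))
        (by omega : 0 < n (ν + 1))
      have := (hpairs (ν + 1) (by omega) h).2.1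
      omega
  have hcop : ∀ ν, 1 ≤ ν → ν ≤ g → Nat.Coprime (n ν) (w ν) := by
    intro ν h1 h
    rcases h1.eq_or_lt with rfl | h2
    · rw [hw1]
      exact (hpairs 1 le_rfl h).1.symm
    · rw [hw ν h2 h, Nat.coprime_mul_right_add_right]
      exact (hpairs ν h1 h).1.symm
  have hL : 12 * ∑ ν ∈ Finset.Icc 1 g, ∑ i ∈ Finset.Ioo 0 (n ν), ∑ j ∈ Finset.Ioo 0 (w ν),
        ∑ r ∈ Finset.range (nprod g n ν),
          (if (i : ℚ) / (n ν) + (j : ℚ) / (w ν) < 1 then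
            (1 - ((i : ℚ) / (n ν) + (j : ℚ) / (w ν)) / (nprod g n ν)
               - (r : ℚ) / (nprod g n ν)) ^ 2
          else 0) = varSum g n w := by
    rw [mul_sum, varSum]
    refine sum_congr rfl fun ν hν => ?_
    rw [mem_Icc] at hν
    have a1 := hn ν hν.1 hν.2
    have a2 := hwgt ν hν.1 hν.2
    exact twelve_mul_sum_sq_s7 (n ν) (w ν) _ (by omega) (by omega) (nprod_pos ν hn)
      (hcop ν hν.1 hν.2)
  rw [hL]
  change _ < milnorSum g n w * _
  have hk0 : (0 : ℚ) < k 1 := by exact_mod_cast (hpairs 1 le_rfl (by omega)).2.1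
  set f : ℕ → ℚ := fun h => ((k 1 : ℚ) + (n 1 : ℚ)) / ((k 1 : ℚ) * (nprod h n 0 : ℚ)) with hf
  have hfsucc : ∀ h, f (h + 1) = f h / n (h + 1) := by
    intro h
    simp only [hf]
    rw [nprod_succ h n (Nat.zero_le h), Nat.cast_mul, ← mul_assoc, div_div]
  have hstep : ∀ h, 1 ≤ h → h + 1 ≤ g → f h < 1 →
      milnorSum h n w ≤ (w h : ℚ) * n h * (1 - f h) + 1 →
      varSum h n w ≤ milnorSum h n w * (1 - f h) →
      varSum (h + 1) n w < milnorSum (h + 1) n w * (1 - f (h + 1)) := by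
    intro h h1 h2 hf1 hM hV
    have b1 : (2 : ℚ) ≤ n h := by exact_mod_cast hn h h1 (by omega)
    have b2 : (2 : ℚ) ≤ w h := by exact_mod_cast hwgt h h1 (by omega)
    have b3 : (1 : ℚ) < n (h + 1) := by exact_mod_cast hn (h + 1) (by omega) h2
    have b4 : (1 : ℚ) ≤ k (h + 1) := by exact_mod_cast (hpairs (h + 1) (by omega) h2).2.1
    rw [hfsucc]
    refine step_lt (varSum h n w) _ (milnorSum h n w) _ (f h) (n (h + 1)) (w h * n h)
      (w (h + 1)) (k (h + 1)) (((w h : ℚ) - 1) * ((n h : ℚ) - 1)) b3 (by positivity) b4 ?_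
      (by nlinarith) hf1 hM (milnorSum_succ h n w) hV ?_
    · rw [hw (h + 1) (by omega) h2, Nat.add_sub_cancel]
      push_cast
      ring
    · have := varSum_succ_le h n w h1 (fun ν c d => hn ν c (by omega))
        (fun ν c d => hwgt ν c (by omega))
      rwa [mul_comm (n h : ℚ) (w h : ℚ)] at this
  have hinv : ∀ h, 1 ≤ h → h ≤ g → f h < 1 ∧
      milnorSum h n w ≤ (w h : ℚ) * n h * (1 - f h) + 1 ∧
      varSum h n w ≤ milnorSum h n w * (1 - f h) := by
    intro h h1
    induction h, h1 using Nat.le_induction with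
    | base =>
      intro h
      have b1 : (2 : ℚ) ≤ n 1 := by exact_mod_cast hn 1 le_rfl h
      have b2 : (n 1 : ℚ) < k 1 := by exact_mod_cast hk1
      have hf1 : f 1 = ((k 1 : ℚ) + n 1) / (k 1 * n 1) := by simp [hf, nprod]
      have hm1 : milnorSum 1 n w = ((k 1 : ℚ) - 1) * (n 1 - 1) := by
        simp [milnorSum, nprod_self, hw1]
      have hv1 : varSum 1 n w = ((k 1 : ℚ) - 1) * (n 1 - 1) * (1 - 1 / n 1 - 1 / k 1) := by
        simp only [varSum, Icc_self, sum_singleton, nprod_self, hw1]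
        push_cast
        ring
      rw [hf1, hm1, hv1, hw1]
      refine ⟨?_, le_of_eq ?_, le_of_eq ?_⟩
      · rw [div_lt_one (by positivity)]
        nlinarith
      · field_simp
        ring
      · field_simp
        ring
    | succ h h1 ih =>
      intro h2
      obtain ⟨i1, i2, i3⟩ := ih (by omega)
      refine ⟨?_, ?_, (hstep h h1 h2 i1 i2 i3).le⟩
      all_goals
        have b3 : (1 : ℚ) < n (h + 1) := by exact_mod_cast hn (h + 1) (by omega) h2
        have b4 : (1 : ℚ) ≤ k (h + 1) := by exact_mod_cast (hpairs (h + 1) (by omega) h2).2.1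
        rw [hfsucc]
      · rw [div_lt_one (by linarith)]
        linarith
      · have e : (w (h + 1) : ℚ) = w h * n h * n (h + 1) + k (h + 1) := by
          rw [hw (h + 1) (by omega) h2, Nat.add_sub_cancel]
          push_cast
          ring
        have e2 : (w (h + 1) : ℚ) * n (h + 1) * (1 - f h / n (h + 1))
            = w (h + 1) * (n (h + 1) - f h) := by
          field_simp
        rw [milnorSum_succ, e2, e]
        nlinarith [mul_le_mul_of_nonneg_left i2 (by linarith : (0 : ℚ) ≤ n (h + 1)),
          mul_nonneg (by linarith : (0 : ℚ) ≤ k (h + 1)) (sub_nonneg.2 i1.le)]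
  obtain ⟨h, rfl⟩ : ∃ h, g = h + 1 := ⟨g - 1, by omega⟩
  obtain ⟨i1, i2, i3⟩ := hinv h (by omega) (by omega)
  exact hstep h (by omega) le_rfl i1 i2 i3
end

section
/- Let k, n be coprime positive integers with n > 1, with Euclidean algorithm data r₀,…,r_{h+1}, a₁,…,a_h and convergent vectors vᵢ = (Pᵢ,Qᵢ) as in the context. Let m̄₋₁ be a real number, set m̄₀ = 0, and define m̄ᵢ = aᵢ(rᵢ + m̄_{i−1}) + m̄_{i−2} for 1 ≤ i ≤ h. Then for 1 ≤ i ≤ h: m̄ᵢ = n·Pᵢ + m̄₋₁·Qᵢ if i is odd, and m̄ᵢ = (m̄₋₁ + k)·Qᵢ if i is even. (These numbers are the normalized multiplicities of the pull-back of the defining equation along the exceptional divisors of the canonical embedded resolution.) -/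
/-- **Lemma 3.3.** Let `k, n` be coprime positive integers with `n > 1`, with
Euclidean algorithm data `r₀ = k`, `r₁ = n`, `aᵢ = ⌊r_{i−1}/rᵢ⌋`,
`r_{i+1} = r_{i−1} − aᵢ rᵢ` (for `1 ≤ i ≤ h`, with `r_h = 1`, `r_{h+1} = 0`),
and convergents `v₋₁ = (0,1)`, `v₀ = (1,0)`, `vᵢ = aᵢ v_{i−1} + v_{i−2}`,
`vᵢ = (Pᵢ, Qᵢ)`.  Let `m̄₋₁` be a real number, `m̄₀ = 0`, and
`m̄ᵢ = aᵢ(rᵢ + m̄_{i−1}) + m̄_{i−2}` for `1 ≤ i ≤ h`.  Then for `1 ≤ i ≤ h`: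
`m̄ᵢ = n Pᵢ + m̄₋₁ Qᵢ` if `i` is odd, and `m̄ᵢ = (m̄₋₁ + k) Qᵢ` if `i` is even. -/
theorem multiplicity_formula (k n h : ℕ) (hk : 0 < k) (hn : 1 < n)
    (hcop : Nat.Coprime k n) (hh : 1 ≤ h)
    (r a : ℕ → ℤ)
    (hr0 : r 0 = (k : ℤ)) (hr1 : r 1 = (n : ℤ))
    (ha : ∀ i, 1 ≤ i → i ≤ h → a i = r (i - 1) / r i)
    (hrrec : ∀ i, 1 ≤ i → i ≤ h → r (i + 1) = r (i - 1) - a i * r i)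
    (hrh : r h = 1) (hrh1 : r (h + 1) = 0)
    (P Q : ℤ → ℤ)
    (hPm1 : P (-1) = 0) (hP0 : P 0 = 1) (hQm1 : Q (-1) = 1) (hQ0 : Q 0 = 0)
    (hPQ : ∀ i : ℕ, 1 ≤ i → i ≤ h →
      P i = a i * P ((i : ℤ) - 1) + P ((i : ℤ) - 2) ∧
      Q i = a i * Q ((i : ℤ) - 1) + Q ((i : ℤ) - 2))
    (mb : ℤ → ℝ)
    (hmb0 : mb 0 = 0)
    (hmbrec : ∀ i : ℕ, 1 ≤ i → i ≤ h →
      mb i = (a i : ℝ) * ((r i : ℝ) + mb ((i : ℤ) - 1)) + mb ((i : ℤ) - 2)) :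
    ∀ i : ℕ, 1 ≤ i → i ≤ h →
      (Odd i → mb i = (n : ℝ) * (P i : ℝ) + mb (-1) * (Q i : ℝ)) ∧
      (Even i → mb i = (mb (-1) + (k : ℝ)) * (Q i : ℝ)) := by
  have key : ∀ i : ℕ, i ≤ h →
      (Even i → mb i = (mb (-1) + k) * Q i ∧
        mb ((i : ℤ) - 1) = n * P ((i : ℤ) - 1) + mb (-1) * Q ((i : ℤ) - 1) ∧
        r (i + 1) = n * P i - k * Q i ∧
        r i = k * Q ((i : ℤ) - 1) - n * P ((i : ℤ) - 1)) ∧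
      (Odd i → mb i = n * P i + mb (-1) * Q i ∧
        mb ((i : ℤ) - 1) = (mb (-1) + k) * Q ((i : ℤ) - 1) ∧
        r (i + 1) = k * Q i - n * P i ∧
        r i = n * P ((i : ℤ) - 1) - k * Q ((i : ℤ) - 1)) := by
    intro i
    induction i with
    | zero => simp [hmb0, hPm1, hP0, hQm1, hQ0, hr0, hr1]
    | succ i ih =>
      intro hi
      obtain ⟨hP, hQ⟩ := hPQ (i + 1) (by omega) hi
      have hm := hmbrec (i + 1) (by omega) hi
      have hr := hrrec (i + 1) (by omega) hi
      have e1 : ((i + 1 : ℕ) : ℤ) - 1 = i := by push_cast; ring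
      have e2 : ((i + 1 : ℕ) : ℤ) - 2 = (i : ℤ) - 1 := by push_cast; ring
      rw [e1, e2] at hP hQ hm
      rw [Nat.add_sub_cancel] at hr
      rw [e1, hm, hr, hP, hQ]
      obtain ⟨hEven, hOdd⟩ := ih (by omega)
      constructor
      · intro hpar
        obtain ⟨h1, h2, h3, h4⟩ := hOdd (by rwa [Nat.even_add_one, Nat.not_even_iff_odd] at hpar)
        refine ⟨?_, h1, ?_, h3⟩
        · rw [h1, h2, h3]; push_cast; ring
        · rw [h3, h4]; ring
      · intro hpar
        obtain ⟨h1, h2, h3, h4⟩ := hEven (by rwa [Nat.odd_add_one, Nat.not_odd_iff_even] at hpar)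
        refine ⟨?_, h1, ?_, h3⟩
        · rw [h1, h2, h3]; push_cast; ring
        · rw [h3, h4]; ring
  intro i _ hi
  exact ⟨fun hodd => ((key i hi).2 hodd).1, fun heven => ((key i hi).1 heven).1⟩
end

section
/- Let w, n be coprime positive integers and let n' be a positive integer. Then every integer c with 0 ≤ c < w·n·n' can be written uniquely as c = i·w + j·n + r·w·n with integers i, j, r satisfying 0 ≤ i < n, 0 ≤ i·w + j·n < w·n, and 0 ≤ r < n'. -/
/-- For coprime `w` and `n > 0`, every integer is uniquely `i w + j n` with `0 ≤ i < n`. -/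
theorem existsUnique_mul_add_mul {w n : ℤ} (hn : 0 < n) (hcop : IsCoprime w n) (m : ℤ) :
    ∃! p : ℤ × ℤ, m = p.1 * w + p.2 * n ∧ 0 ≤ p.1 ∧ p.1 < n := by
  obtain ⟨a, b, hab⟩ := hcop
  refine ⟨(m * a % n, m * b + m * a / n * w), ⟨?_, Int.emod_nonneg _ hn.ne',
    Int.emod_lt_of_pos _ hn⟩, ?_⟩
  · linear_combination -m * hab - w * Int.emod_add_mul_ediv (m * a) n
  · rintro ⟨i, j⟩ ⟨h, hi₀, hi₁⟩
    dsimp only at h hi₀ hi₁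
    have hi : m * a % n = i := by
      rw [← Int.emod_eq_of_lt hi₀ hi₁]
      refine Int.ModEq.symm (Int.modEq_iff_dvd.mpr ⟨j * a - i * b, ?_⟩)
      linear_combination a * h + i * hab
    have hj : j = m * b + m * a / n * w := by
      refine mul_right_cancel₀ hn.ne' ?_
      linear_combination -h - m * hab + w * hi - w * Int.emod_add_mul_ediv (m * a) n
    rw [hi, ← hj]

/-- **(4.3).** Let `w, n` be coprime positive integers and `n'` a positive integer.
Every integer `c` with `0 ≤ c < w n n'` is uniquely written as
`c = i w + j n + r w n` with integers `i, j, r` satisfying `0 ≤ i < n`,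
`0 ≤ i w + j n < w n` and `0 ≤ r < n'`. -/
theorem unique_representation (w n n' : ℕ) (hw : 0 < w) (hn : 0 < n) (hn' : 0 < n')
    (hcop : Nat.Coprime w n) :
    ∀ c : ℤ, 0 ≤ c → c < (w : ℤ) * n * n' →
      ∃! t : ℤ × ℤ × ℤ,
        c = t.1 * w + t.2.1 * n + t.2.2 * ((w : ℤ) * n) ∧
        0 ≤ t.1 ∧ t.1 < (n : ℤ) ∧
        0 ≤ t.1 * w + t.2.1 * n ∧ t.1 * w + t.2.1 * n < (w : ℤ) * n ∧
        0 ≤ t.2.2 ∧ t.2.2 < (n' : ℤ) := by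
  intro c hc₀ hc₁
  have hwn : (0 : ℤ) < (w : ℤ) * n := by positivity
  obtain ⟨⟨i, j⟩, ⟨hm, hi₀, hi₁⟩, huniq⟩ := existsUnique_mul_add_mul
    (Int.natCast_pos.mpr hn) (Nat.isCoprime_iff_coprime.mpr hcop) (c % ((w : ℤ) * n))
  dsimp only at hm hi₀ hi₁
  refine ⟨(i, j, c / ((w : ℤ) * n)), ⟨?_, hi₀, hi₁, ?_, ?_, Int.ediv_nonneg hc₀ hwn.le,
    Int.ediv_lt_of_lt_mul hwn (by rwa [mul_comm])⟩, ?_⟩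
  · linear_combination hm - Int.emod_add_mul_ediv c ((w : ℤ) * n)
  · exact hm ▸ Int.emod_nonneg _ hwn.ne'
  · exact hm ▸ Int.emod_lt_of_pos _ hwn
  · rintro ⟨i', j', r'⟩ ⟨h, hi₀', hi₁', hm₀, hm₁, -, -⟩
    dsimp only at h hi₀' hi₁' hm₀ hm₁
    obtain ⟨hr, hm'⟩ := (Int.ediv_emod_unique hwn).mpr
      ⟨show i' * w + j' * n + (w : ℤ) * n * r' = c by linear_combination -h, hm₀, hm₁⟩
    have hij := huniq (i', j') ⟨hm', hi₀', hi₁'⟩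
    simp only [Prod.mk.injEq] at hij ⊢
    exact ⟨hij.1, hij.2, hr.symm⟩
end

section
/- Let w, n be coprime positive integers with n > 1, let n' be a positive integer, and let Q be an integer with Q·w ≡ 1 (mod n). Let c be an integer with 0 ≤ c < w·n·n', written as c = i·w + j·n + r·w·n with integers i, j, r satisfying 0 ≤ i < n, 0 ≤ i·w + j·n < w·n, 0 ≤ r < n'. Then the two conditions [c·(n−Q)/n is not an integer] and [fract(c·Q/n) < fract(c/(w·n))] both hold if and only if i > 0 and j > 0. (This is the criterion for the nonvanishing of the Hodge-theoretic contribution H(α,c) of the exceptional divisor in the computation of the exponents.) -/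
/-- **(4.3), nonvanishing criterion.** Let `w, n` be coprime positive integers with
`n > 1`, `n'` a positive integer, and `Q` an integer with `Q w ≡ 1 (mod n)`.  Let
`c = i w + j n + r w n` with `0 ≤ c < w n n'`, `0 ≤ i < n`, `0 ≤ i w + j n < w n`,
`0 ≤ r < n'`.  Then `c (n − Q)/n ∉ ℤ` and `fract(c Q/n) < fract(c/(w n))` both hold
if and only if `i > 0` and `j > 0`. -/
theorem nonvanishing_criterion (w n n' : ℕ) (hw : 0 < w) (hn : 1 < n) (hn' : 0 < n')
    (hcop : Nat.Coprime w n) (Q : ℤ) (hQ : Q * (w : ℤ) ≡ 1 [ZMOD (n : ℤ)])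
    (c i j r : ℤ) (hc0 : 0 ≤ c) (hc1 : c < (w : ℤ) * n * n')
    (hrep : c = i * w + j * n + r * ((w : ℤ) * n))
    (hi0 : 0 ≤ i) (hi1 : i < (n : ℤ))
    (hij0 : 0 ≤ i * w + j * n) (hij1 : i * w + j * n < (w : ℤ) * n)
    (hr0 : 0 ≤ r) (hr1 : r < (n' : ℤ)) :
    ((¬ ∃ m : ℤ, (c : ℚ) * ((n : ℚ) - (Q : ℚ)) / (n : ℚ) = (m : ℚ)) ∧
      Int.fract ((c : ℚ) * (Q : ℚ) / (n : ℚ)) < Int.fract ((c : ℚ) / ((w : ℚ) * (n : ℚ))))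
      ↔ (0 < i ∧ 0 < j) := by
  have hnQ : (0 : ℚ) < n := by exact_mod_cast (by omega : 0 < n)
  have hwQ : (0 : ℚ) < w := by exact_mod_cast hw
  obtain ⟨k, hk⟩ := hQ.symm.dvd
  have hcQ : c * Q = i + n * (i * k + j * Q + r * w * Q) := by
    linear_combination Q * hrep + i * hk
  have hfract_left : Int.fract ((c : ℚ) * Q / n) = i / n := by
    rw [Int.fract_eq_iff]
    refine ⟨by positivity, ?_, i * k + j * Q + r * w * Q, ?_⟩
    · rw [div_lt_one hnQ]
      exact_mod_cast hi1
    · have h : (c : ℚ) * Q = i + n * (i * k + j * Q + r * w * Q) := by exact_mod_cast hcQ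
      rw [h]
      push_cast
      field_simp
      ring
  have hfract_right : Int.fract ((c : ℚ) / (w * n)) = i / n + j / w := by
    have hsum : (i : ℚ) / n + j / w = (i * w + j * n) / (w * n) := by field_simp
    rw [hsum, Int.fract_eq_iff]
    refine ⟨div_nonneg (by exact_mod_cast hij0) (by positivity), ?_, r, ?_⟩
    · rw [div_lt_one (by positivity)]
      exact_mod_cast hij1
    · have h : (c : ℚ) = i * w + j * n + r * (w * n) := by exact_mod_cast hrep
      rw [h]
      field_simp
      ring
  have hinteger :
      (∃ m : ℤ, (c : ℚ) * ((n : ℚ) - (Q : ℚ)) / (n : ℚ) = (m : ℚ)) ↔ i = 0 := by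
    constructor
    · rintro ⟨m, hm⟩
      rw [div_eq_iff hnQ.ne'] at hm
      have hm' : c * (n - Q) = m * n := by exact_mod_cast hm
      refine Int.eq_zero_of_dvd_of_nonneg_of_lt hi0 hi1
        ⟨c - m - (i * k + j * Q + r * w * Q), ?_⟩
      linear_combination -hm' - hcQ
    · rintro rfl
      refine ⟨c - (j * Q + r * w * Q), ?_⟩
      rw [div_eq_iff hnQ.ne']
      have h : c * (n - Q) = (c - (j * Q + r * w * Q)) * n := by linear_combination -hcQ
      exact_mod_cast h
  rw [hinteger, hfract_left, hfract_right, lt_add_iff_pos_right, div_pos_iff_of_pos_right hwQ,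
    Int.cast_pos]
  exact and_congr_left' hi0.lt_iff_ne'.symm
end
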